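/- arXiv:1509.03671 — 2 statements merged into one kernel-verified Lean document; each statement's English description precedes it below -/
import Mathlib

section
/- (Normal form and expressive completeness) (a) For every formula φ of propositional team logic whose variables are among p₁,…,pₙ, there is a finite collection {Xᵢ : i∈I} of teams on {p₁,…,pₙ} such that φ ≡ ⋁_{i∈I} Θ_{Xᵢ}. (b) For every nonempty downward-closed collection K of teams on V = {p₁,…,pₙ} (i.e., Y ⊆ X ∈ K implies Y ∈ K), the formula ⋁_{X∈K} Θ_X defines K: for every team Y on V, Y ⊨ ⋁_{X∈K} Θ_X if and only if Y ∈ K. -/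
inductive PTForm : Type
  | var : ℕ → PTForm
  | bot : PTForm
  | top : PTForm
  | neg : PTForm → PTForm
  | conj : PTForm → PTForm → PTForm
  | tensor : PTForm → PTForm → PTForm
  | disj : PTForm → PTForm → PTForm
  | impl : PTForm → PTForm → PTForm
  | dep : List PTForm → PTForm → PTForm

abbrev Val := ℕ → Bool
abbrev Team := Set Val

def PTSat : Team → PTForm → Prop
  | X, .var n => ∀ v ∈ X, v n = true
  | X, .bot => X = ∅
  | _, .top => True
  | X, .neg φ => ∀ v ∈ X, ¬ PTSat {v} φ
  | X, .conj φ ψ => PTSat X φ ∧ PTSat X ψ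
  | X, .tensor φ ψ => ∃ Y Z, X = Y ∪ Z ∧ PTSat Y φ ∧ PTSat Z ψ
  | X, .disj φ ψ => PTSat X φ ∨ PTSat X ψ
  | X, .impl φ ψ => ∀ Y ⊆ X, PTSat Y φ → PTSat Y ψ
  | X, .dep l ψ => ∀ Y ⊆ X,
      (∀ φ ∈ l, PTSat Y φ ∨ (∀ v ∈ Y, ¬ PTSat {v} φ)) →
      (PTSat Y ψ ∨ (∀ v ∈ Y, ¬ PTSat {v} ψ))

def PTValid (φ : PTForm) : Prop := ∀ X : Team, PTSat X φ
def PTConseq (φ ψ : PTForm) : Prop := ∀ X : Team, PTSat X φ → PTSat X ψ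
def PTEquiv (φ ψ : PTForm) : Prop := ∀ X : Team, PTSat X φ ↔ PTSat X ψ
def PTSetConseq (Γ : Set PTForm) (φ : PTForm) : Prop :=
  ∀ X : Team, (∀ ψ ∈ Γ, PTSat X ψ) → PTSat X φ
def Flat (φ : PTForm) : Prop :=
  ∀ X : Team, PTSat X φ ↔ ∀ v ∈ X, PTSat {v} φ

/-- All propositional variables of a formula are among `p_0, …, p_{n-1}`. -/
def VarsBelow (n : ℕ) : PTForm → Prop
  | .var m => m < n
  | .bot => True
  | .top => True
  | .neg φ => VarsBelow n φ
  | .conj φ ψ => VarsBelow n φ ∧ VarsBelow n ψ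
  | .tensor φ ψ => VarsBelow n φ ∧ VarsBelow n ψ
  | .disj φ ψ => VarsBelow n φ ∧ VarsBelow n ψ
  | .impl φ ψ => VarsBelow n φ ∧ VarsBelow n ψ
  | .dep l ψ => (∀ φ ∈ l, VarsBelow n φ) ∧ VarsBelow n ψ

/-- The restriction of a valuation to the variables `p_0, …, p_{n-1}`. -/
def restrict (n : ℕ) (v : Val) : Fin n → Bool := fun i => v i.val

/-- The team of all valuations whose restriction to `p_0, …, p_{n-1}` lies in
a given team on those variables. -/
def liftTeam (n : ℕ) (Y : Set (Fin n → Bool)) : Team :=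
  {w : Val | restrict n w ∈ Y}

/-- Finite intuitionistic disjunction (`⊥` for the empty list). -/
def bigDisj (l : List PTForm) : PTForm := l.foldr .disj .bot

/-- Finite tensor disjunction (`⊥` for the empty list). -/
def bigTensor (l : List PTForm) : PTForm := l.foldr .tensor .bot

/-- The conjunction `p_0^{v(p_0)} ∧ … ∧ p_{n-1}^{v(p_{n-1})}`,
where `p¹ = p` and `p⁰ = ¬p`. -/
def literal (n : ℕ) (v : Fin n → Bool) : PTForm :=
  (List.finRange n).foldr
    (fun i acc => .conj (if v i then .var i.val else .neg (.var i.val)) acc) .top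

open Classical in
/-- `Θ_X := ¬¬⋁_{v∈X} (p_0^{v(p_0)} ∧ … ∧ p_{n-1}^{v(p_{n-1})})` for a nonempty
team `X` on `p_0, …, p_{n-1}`, and `Θ_∅ := ⊥`. -/
noncomputable def Theta (n : ℕ) (X : Set (Fin n → Bool)) : PTForm :=
  if X = ∅ then .bot
  else .neg (.neg (bigDisj (X.toFinite.toFinset.toList.map (literal n))))

/-- `Θ⊗_X := ⨂_{v∈X} (p_0^{v(p_0)} ∧ … ∧ p_{n-1}^{v(p_{n-1})})`
(the tensor normal form; `⊥` for `X = ∅`). -/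
noncomputable def ThetaTensor (n : ℕ) (X : Set (Fin n → Bool)) : PTForm :=
  bigTensor (X.toFinite.toFinset.toList.map (literal n))

abbrev Subst := ℕ → PTForm

def applySubst (σ : Subst) : PTForm → PTForm
  | .var n => σ n
  | .bot => .bot
  | .top => .top
  | .neg φ => .neg (applySubst σ φ)
  | .conj φ ψ => .conj (applySubst σ φ) (applySubst σ ψ)
  | .tensor φ ψ => .tensor (applySubst σ φ) (applySubst σ ψ)
  | .disj φ ψ => .disj (applySubst σ φ) (applySubst σ ψ)
  | .impl φ ψ => .impl (applySubst σ φ) (applySubst σ ψ)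
  | .dep l ψ => .dep (l.attach.map (fun x => applySubst σ x.1)) (applySubst σ ψ)
decreasing_by
  all_goals simp_wf
  all_goals first
    | (have := List.sizeOf_lt_of_mem x.2; omega)
    | omega

def FlatSubst (σ : Subst) : Prop := ∀ n : ℕ, Flat (σ n)

open Classical in
noncomputable def valSub (σ : Subst) (v : Val) : Val :=
  fun p => if PTSat {v} (σ p) then true else false

noncomputable def teamSub (σ : Subst) (X : Team) : Team := valSub σ '' X

/-- A formula is F-projective if some flat substitution unifies it and is,
modulo the formula, the identity on variables. -/
def FProjective (φ : PTForm) : Prop :=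
  ∃ σ : Subst, FlatSubst σ ∧ PTValid (applySubst σ φ) ∧
    ∀ p : ℕ,
      (∀ X : Team, PTSat X φ → PTSat X (σ p) → PTSat X (.var p)) ∧
      (∀ X : Team, PTSat X φ → PTSat X (.var p) → PTSat X (σ p))

/-- Prucnal's substitution determined by a formula `θ` and a valuation `v` on
`p_0, …, p_{n-1}`: `σ(p) = θ ∧ p` if `v(p) = 0` and `σ(p) = θ → p` if
`v(p) = 1` (identity outside the domain of `v`). -/
def prucnal (θ : PTForm) (n : ℕ) (v : Fin n → Bool) : Subst :=
  fun p => if h : p < n then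
      (if v ⟨p, h⟩ then .impl θ (.var p) else .conj θ (.var p))
    else .var p

/-- The variant of Prucnal's substitution used for the tensor normal form:
`σ(p) = θ ∧ p` if `v(p) = 0` and `σ(p) = ¬θ ⊗ p` if `v(p) = 1`. -/
def prucnalT (θ : PTForm) (n : ℕ) (v : Fin n → Bool) : Subst :=
  fun p => if h : p < n then
      (if v ⟨p, h⟩ then .tensor (.neg θ) (.var p) else .conj θ (.var p))
    else .var p

/-- A formula contains no dependence atoms and no intuitionistic disjunction. -/
def IsClassical : PTForm → Prop
  | .var _ => True
  | .bot => True
  | .top => True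
  | .neg φ => IsClassical φ
  | .conj φ ψ => IsClassical φ ∧ IsClassical ψ
  | .tensor φ ψ => IsClassical φ ∧ IsClassical ψ
  | .disj _ _ => False
  | .impl φ ψ => IsClassical φ ∧ IsClassical ψ
  | .dep _ _ => False

/-- Classical truth-table satisfaction by a single valuation, reading `⊗` as
classical disjunction. -/
def CSat (v : Val) : PTForm → Prop
  | .var n => v n = true
  | .bot => False
  | .top => True
  | .neg φ => ¬ CSat v φ
  | .conj φ ψ => CSat v φ ∧ CSat v ψ
  | .tensor φ ψ => CSat v φ ∨ CSat v ψ
  | .disj φ ψ => CSat v φ ∨ CSat v ψ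
  | .impl φ ψ => CSat v φ → CSat v ψ
  | .dep _ _ => True

/-- Formulas of propositional dependence logic (PD): atoms `p`, `¬p`, `⊥`, `⊤`,
dependence atoms with variable arguments, conjunction and tensor. -/
inductive PDForm : Type
  | pos : ℕ → PDForm
  | negv : ℕ → PDForm
  | bot : PDForm
  | top : PDForm
  | dep : List ℕ → ℕ → PDForm
  | conj : PDForm → PDForm → PDForm
  | tensor : PDForm → PDForm → PDForm

/-- The embedding of PD formulas into PT formulas. -/
def PDForm.toPT : PDForm → PTForm
  | .pos n => .var n
  | .negv n => .neg (.var n)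
  | .bot => .bot
  | .top => .top
  | .dep l q => .dep (l.map .var) (.var q)
  | .conj φ ψ => .conj φ.toPT ψ.toPT
  | .tensor φ ψ => .tensor φ.toPT ψ.toPT

/-- The syntactic (De Morgan) negation `φ~` of a PD formula. -/
def PDForm.synNeg : PDForm → PDForm
  | .pos n => .negv n
  | .negv n => .pos n
  | .bot => .top
  | .top => .bot
  | .dep _ _ => .bot
  | .conj φ ψ => .tensor φ.synNeg ψ.synNeg
  | .tensor φ ψ => .conj φ.synNeg ψ.synNeg

theorem ptSat_bigDisj_iff (X : Team) (l : List PTForm) :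
    PTSat X (bigDisj l) ↔ X = ∅ ∨ ∃ φ ∈ l, PTSat X φ := by
  induction l with
  | nil => simp [bigDisj, PTSat]
  | cons φ l ih =>
    rw [show bigDisj (φ :: l) = .disj φ (bigDisj l) from rfl, PTSat, ih]
    simp only [List.mem_cons, exists_eq_or_imp]
    tauto

theorem ptSat_empty : ∀ φ : PTForm, PTSat ∅ φ
  | .var _ => by simp [PTSat]
  | .bot => by simp [PTSat]
  | .top => by simp [PTSat]
  | .neg _ => by simp [PTSat]
  | .conj φ ψ => by simp [PTSat, ptSat_empty φ, ptSat_empty ψ]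
  | .tensor φ ψ => by
    rw [PTSat]
    exact ⟨∅, ∅, by simp, ptSat_empty φ, ptSat_empty ψ⟩
  | .disj φ ψ => by simp [PTSat, ptSat_empty φ]
  | .impl φ ψ => by simp [PTSat, ptSat_empty ψ]
  | .dep _ _ => by simp [PTSat]

theorem PTSat.mono : ∀ (φ : PTForm) {X Y : Team}, Y ⊆ X → PTSat X φ → PTSat Y φ
  | .var _, _, _, h, hX => by
    rw [PTSat] at hX ⊢
    exact fun v hv => hX v (h hv)
  | .bot, _, _, h, hX => by
    rw [PTSat] at hX ⊢
    exact Set.subset_eq_empty h hX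
  | .top, _, _, _, _ => by simp [PTSat]
  | .neg _, _, _, h, hX => by
    rw [PTSat] at hX ⊢
    exact fun v hv => hX v (h hv)
  | .conj φ ψ, _, _, h, hX => by
    rw [PTSat] at hX ⊢
    exact ⟨PTSat.mono φ h hX.1, PTSat.mono ψ h hX.2⟩
  | .tensor φ ψ, X, Y, h, hX => by
    rw [PTSat] at hX ⊢
    obtain ⟨Z, W, rfl, hZ, hW⟩ := hX
    refine ⟨Y ∩ Z, Y ∩ W, ?_, PTSat.mono φ Set.inter_subset_right hZ,
      PTSat.mono ψ Set.inter_subset_right hW⟩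
    rw [← Set.inter_union_distrib_left, Set.inter_eq_left.2 h]
  | .disj φ ψ, _, _, h, hX => by
    rw [PTSat] at hX ⊢
    exact hX.imp (PTSat.mono φ h) (PTSat.mono ψ h)
  | .impl _ _, _, _, h, hX => by
    rw [PTSat] at hX ⊢
    exact fun Z hZ => hX Z (hZ.trans h)
  | .dep _ _, _, _, h, hX => by
    rw [PTSat] at hX ⊢
    exact fun Z hZ => hX Z (hZ.trans h)

theorem image_inter_preimage_image_eq {α β : Type*} {f : α → β} {X Y Z : Set α}
    (h : f '' X = f '' Y) (hZ : Z ⊆ X) : f '' (Y ∩ f ⁻¹' (f '' Z)) = f '' Z := by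
  rw [Set.image_inter_preimage, ← h, Set.inter_eq_right]
  exact Set.image_mono hZ

/-- If satisfaction of `φ` depends only on restrictions of teams, so does its failure at
every valuation of a team. -/
theorem forall_not_singleton_of_image_eq {n : ℕ} {φ : PTForm}
    (hφ : ∀ {X Y : Team}, restrict n '' X = restrict n '' Y → PTSat X φ → PTSat Y φ)
    {X Y : Team} (h : restrict n '' X = restrict n '' Y)
    (hX : ∀ v ∈ X, ¬ PTSat {v} φ) : ∀ v ∈ Y, ¬ PTSat {v} φ := by
  intro v hv hs
  obtain ⟨w, hw, hwv⟩ := h ▸ Set.mem_image_of_mem (restrict n) hv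
  exact hX w hw (hφ (by simp [hwv]) hs)

/-- Satisfaction depends only on the restriction of a team to the variables of the formula. -/
theorem PTSat.of_image_restrict_eq {n : ℕ} : ∀ (φ : PTForm), VarsBelow n φ →
    ∀ {X Y : Team}, restrict n '' X = restrict n '' Y → PTSat X φ → PTSat Y φ
  | .var m, hv, X, Y, h, hX => by
    rw [VarsBelow] at hv
    rw [PTSat] at hX ⊢
    intro v hvY
    obtain ⟨w, hw, hwv⟩ := h ▸ Set.mem_image_of_mem (restrict n) hvY
    exact (congrFun hwv ⟨m, hv⟩).symm.trans (hX w hw)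
  | .bot, _, X, Y, h, hX => by
    rw [PTSat] at hX ⊢
    rw [hX, Set.image_empty] at h
    exact Set.image_eq_empty.1 h.symm
  | .top, _, _, _, _, _ => by simp [PTSat]
  | .neg φ, hv, X, Y, h, hX => by
    rw [VarsBelow] at hv
    rw [PTSat] at hX ⊢
    exact forall_not_singleton_of_image_eq (PTSat.of_image_restrict_eq φ hv) h hX
  | .conj φ ψ, hv, _, _, h, hX => by
    rw [VarsBelow] at hv
    rw [PTSat] at hX ⊢
    exact ⟨PTSat.of_image_restrict_eq φ hv.1 h hX.1, PTSat.of_image_restrict_eq ψ hv.2 h hX.2⟩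
  | .tensor φ ψ, hv, X, Y, h, hX => by
    rw [VarsBelow] at hv
    rw [PTSat] at hX ⊢
    obtain ⟨Z, W, rfl, hZ, hW⟩ := hX
    refine ⟨_, _, ?_,
      PTSat.of_image_restrict_eq φ hv.1
        (image_inter_preimage_image_eq h Set.subset_union_left).symm hZ,
      PTSat.of_image_restrict_eq ψ hv.2
        (image_inter_preimage_image_eq h Set.subset_union_right).symm hW⟩
    rw [← Set.inter_union_distrib_left, ← Set.preimage_union, ← Set.image_union, h,
      Set.inter_eq_left.2 (Set.subset_preimage_image _ _)]
  | .disj φ ψ, hv, _, _, h, hX => by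
    rw [VarsBelow] at hv
    rw [PTSat] at hX ⊢
    exact hX.imp (PTSat.of_image_restrict_eq φ hv.1 h) (PTSat.of_image_restrict_eq ψ hv.2 h)
  | .impl φ ψ, hv, X, Y, h, hX => by
    rw [VarsBelow] at hv
    rw [PTSat] at hX ⊢
    intro Z hZ hs
    have hZ' := image_inter_preimage_image_eq h.symm hZ
    exact PTSat.of_image_restrict_eq ψ hv.2 hZ'
      (hX _ Set.inter_subset_left (PTSat.of_image_restrict_eq φ hv.1 hZ'.symm hs))
  | .dep l ψ, hv, X, Y, h, hX => by
    rw [VarsBelow] at hv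
    rw [PTSat] at hX ⊢
    intro Z hZ hs
    have hZ' := image_inter_preimage_image_eq h.symm hZ
    have hψ : ∀ {X Y : Team}, restrict n '' X = restrict n '' Y → PTSat X ψ → PTSat Y ψ :=
      PTSat.of_image_restrict_eq ψ hv.2
    refine (hX _ Set.inter_subset_left fun φ hφ => ?_).imp (hψ hZ')
      (forall_not_singleton_of_image_eq hψ hZ')
    have hφ' : ∀ {X Y : Team}, restrict n '' X = restrict n '' Y → PTSat X φ → PTSat Y φ :=
      PTSat.of_image_restrict_eq φ (hv.1 φ hφ)
    exact (hs φ hφ).imp (hφ' hZ'.symm) (forall_not_singleton_of_image_eq hφ' hZ'.symm)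
termination_by φ => sizeOf φ
decreasing_by
  all_goals simp_wf
  all_goals first
    | omega
    | (have := List.sizeOf_lt_of_mem hφ; omega)

theorem ptSat_foldr_conj_iff {ι : Type*} (X : Team) (f : ι → PTForm) (l : List ι) :
    PTSat X (l.foldr (fun i acc => .conj (f i) acc) .top) ↔ ∀ i ∈ l, PTSat X (f i) := by
  induction l with
  | nil => simp [PTSat]
  | cons i l ih => simp [PTSat, ih]

theorem ptSat_literal_iff (n : ℕ) (X : Team) (v : Fin n → Bool) :
    PTSat X (literal n v) ↔ ∀ w ∈ X, restrict n w = v := by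
  have key (i : Fin n) : PTSat X (if v i then .var i.val else .neg (.var i.val)) ↔
      ∀ w ∈ X, w i = v i := by
    cases v i <;> simp [PTSat]
  rw [literal, ptSat_foldr_conj_iff]
  simp only [List.mem_finRange, true_imp_iff, key, funext_iff, restrict]
  exact ⟨fun h w hw i => h i w hw, fun h i w hw => h w hw i⟩

theorem ptSat_Theta_iff (n : ℕ) (Y : Team) (X : Set (Fin n → Bool)) :
    PTSat Y (Theta n X) ↔ ∀ w ∈ Y, restrict n w ∈ X := by
  rw [Theta]
  split_ifs with h
  · simp [PTSat, h, Set.eq_empty_iff_forall_notMem]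
  · simp [PTSat, ptSat_bigDisj_iff, ptSat_literal_iff]

theorem restrict_surjective (n : ℕ) : Function.Surjective (restrict n) := fun v =>
  ⟨fun m => if h : m < n then v ⟨m, h⟩ else false, by ext i; simp [restrict]⟩

theorem image_restrict_liftTeam (n : ℕ) (X : Set (Fin n → Bool)) :
    restrict n '' liftTeam n X = X :=
  Set.image_preimage_eq X (restrict_surjective n)

/-- Normal form and expressive completeness. -/
theorem pt_normal_form_expressive_completeness (n : ℕ) :
    (∀ φ : PTForm, VarsBelow n φ →
      ∃ l : List (Set (Fin n → Bool)), PTEquiv φ (bigDisj (l.map (Theta n)))) ∧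
    (∀ K : Set (Set (Fin n → Bool)), K.Nonempty →
      (∀ X ∈ K, ∀ Y : Set (Fin n → Bool), Y ⊆ X → Y ∈ K) →
      ∀ Y : Set (Fin n → Bool),
        PTSat (liftTeam n Y) (bigDisj (K.toFinite.toFinset.toList.map (Theta n))) ↔
          Y ∈ K) := by
  refine ⟨fun φ hφ => ?_, fun K ⟨X₀, hX₀⟩ hK Y => ?_⟩
  · refine ⟨{X | PTSat (liftTeam n X) φ}.toFinite.toFinset.toList, fun Y => ?_⟩
    simp only [ptSat_bigDisj_iff, List.mem_map, Finset.mem_toList, Set.Finite.mem_toFinset,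
      Set.mem_ofPred_eq, exists_exists_and_eq_and, ptSat_Theta_iff]
    constructor
    · intro h
      exact .inr ⟨restrict n '' Y, PTSat.of_image_restrict_eq φ hφ
        (image_restrict_liftTeam n _).symm h, fun w hw => Set.mem_image_of_mem _ hw⟩
    · rintro (rfl | ⟨X, hX, hYX⟩)
      · exact ptSat_empty φ
      · exact PTSat.mono φ hYX hX
  · simp only [ptSat_bigDisj_iff, List.mem_map, Finset.mem_toList, Set.Finite.mem_toFinset,
      exists_exists_and_eq_and, ptSat_Theta_iff]
    constructor
    · rintro (h | ⟨X, hX, hYX⟩)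
      · rw [← image_restrict_liftTeam n Y, h, Set.image_empty]
        exact hK X₀ hX₀ ∅ (Set.empty_subset _)
      · refine hK X hX Y ?_
        rw [← image_restrict_liftTeam n Y]
        exact Set.image_subset_iff.2 hYX
    · exact fun h => .inr ⟨Y, h, fun w hw => hw⟩
end

section
/- The semantic consequence relation of propositional team logic is closed under flat substitutions: for all formulas φ, ψ and every flat substitution σ, if φ ⊨ ψ then σ(φ) ⊨ σ(ψ). In particular, φ ≡ ψ implies σ(φ) ≡ σ(ψ). -/
theorem teamSub_singleton (σ : Subst) (v : Val) : teamSub σ {v} = {valSub σ v} := by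
  simp [teamSub]

/-- Quantifying over the subteams of `teamSub σ X` amounts to quantifying over those of `X`. -/
theorem forall_subset_teamSub_iff (σ : Subst) (X : Team) (P : Team → Prop) :
    (∀ Y ⊆ teamSub σ X, P Y) ↔ ∀ Y ⊆ X, P (teamSub σ Y) :=
  Set.forall_subset_image_iff

/-- A team satisfies `σ(φ)` iff its image under `σ` satisfies `φ`, for flat `σ`. -/
theorem ptSat_applySubst (σ : Subst) (hσ : FlatSubst σ) :
    ∀ (φ : PTForm) (X : Team), PTSat X (applySubst σ φ) ↔ PTSat (teamSub σ X) φ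
  | .var n, X => by
    rw [applySubst, PTSat, hσ n X]
    simp [teamSub, valSub]
  | .bot, X => by simp [applySubst, PTSat, teamSub]
  | .top, X => by simp [applySubst, PTSat]
  | .neg φ, X => by
    have ih := ptSat_applySubst σ hσ φ
    simp only [applySubst, PTSat, ih, teamSub_singleton]
    simp [teamSub]
  | .conj φ ψ, X => by
    simp only [applySubst, PTSat, ptSat_applySubst σ hσ φ, ptSat_applySubst σ hσ ψ]
  | .tensor φ ψ, X => by
    simp only [applySubst, PTSat, ptSat_applySubst σ hσ φ, ptSat_applySubst σ hσ ψ]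
    constructor
    · rintro ⟨Y, Z, rfl, hY, hZ⟩
      exact ⟨_, _, Set.image_union _ _ _, hY, hZ⟩
    · rintro ⟨Y, Z, h, hY, hZ⟩
      have image_eq {W : Team} (hW : W ⊆ teamSub σ X) :
          teamSub σ (X ∩ valSub σ ⁻¹' W) = W := by
        rw [teamSub, Set.image_inter_preimage]
        exact Set.inter_eq_right.mpr hW
      refine ⟨X ∩ valSub σ ⁻¹' Y, X ∩ valSub σ ⁻¹' Z, ?_, ?_, ?_⟩
      · rw [← Set.inter_union_distrib_left, ← Set.preimage_union, ← h]
        exact (Set.inter_eq_left.mpr (Set.subset_preimage_image _ _)).symm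
      · rwa [image_eq (h ▸ Set.subset_union_left)]
      · rwa [image_eq (h ▸ Set.subset_union_right)]
  | .disj φ ψ, X => by
    simp only [applySubst, PTSat, ptSat_applySubst σ hσ φ, ptSat_applySubst σ hσ ψ]
  | .impl φ ψ, X => by
    simp only [applySubst, PTSat, ptSat_applySubst σ hσ φ, ptSat_applySubst σ hσ ψ,
      forall_subset_teamSub_iff]
  | .dep l ψ, X => by
    have ihl (φ : PTForm) (hφ : φ ∈ l) (Y : Team) := ptSat_applySubst σ hσ φ Y
    have neg_iff (φ : PTForm) (Y : Team) :
        (∀ v ∈ teamSub σ Y, ¬ PTSat {v} φ) ↔ ∀ v ∈ Y, ¬ PTSat (teamSub σ {v}) φ := by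
      simp [teamSub]
    simp only [applySubst, PTSat, ptSat_applySubst σ hσ ψ, forall_subset_teamSub_iff, neg_iff]
    refine forall₂_congr fun Y _ => imp_congr ?_ Iff.rfl
    simp only [List.map_attach_eq_pmap, List.mem_pmap, forall_exists_index]
    constructor
    · intro h φ hφ
      simpa only [ihl φ hφ] using h _ φ hφ rfl
    · rintro h _ φ hφ rfl
      simpa only [ihl φ hφ] using h φ hφ
termination_by φ => sizeOf φ
decreasing_by
  all_goals simp_wf
  all_goals first
    | omega
    | (have := List.sizeOf_lt_of_mem hφ; omega)

/-- Consequence is closed under flat substitutions. -/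
theorem pt_conseq_closed_under_flat_subst (σ : Subst) (hσ : FlatSubst σ) :
    (∀ φ ψ : PTForm, PTConseq φ ψ → PTConseq (applySubst σ φ) (applySubst σ ψ)) ∧
    (∀ φ ψ : PTForm, PTEquiv φ ψ → PTEquiv (applySubst σ φ) (applySubst σ ψ)) := by
  simp only [PTConseq, PTEquiv, ptSat_applySubst σ hσ]
  exact ⟨fun _ _ h X => h (teamSub σ X), fun _ _ h X => h (teamSub σ X)⟩
end
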